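/- arXiv:math/0503498 — 2 statements merged into one kernel-verified Lean document; each statement's English description precedes it below -/
import Mathlib

section
/- For every natural number i, Σ_{l=0}^{i} (−1)^l [ ((9i+12)l + 12i+15) · C(3i+4, i−l−1) + (l+2)^2 · C(3i+5, i−l) ] = ((27i^3+101i^2+124i+48)/((3i+3)(3i+4))) · C(3i+4, i). -/
/-- The binomial coefficient `C(n, m)` for a natural upper index `n` and an
integer lower index `m`, which vanishes when `m < 0` (and when `m > n`). -/
def chooseZ (n : ℕ) (m : ℤ) : ℚ :=
  if 0 ≤ m then (Nat.choose n m.toNat : ℚ) else 0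

theorem chooseZ_sub_sub_one (n : ℕ) {i l : ℕ} (h : l ≤ i) :
    chooseZ n ((i : ℤ) - (l : ℤ) - 1) =
      (Nat.choose (n + 1) (i - l) : ℚ) - (Nat.choose n (i - l) : ℚ) := by
  obtain ⟨d, rfl⟩ := Nat.exists_eq_add_of_le h
  have e : ((l + d : ℕ) : ℤ) - (l : ℤ) - 1 = (d : ℤ) - 1 := by push_cast; ring
  rw [e, Nat.add_sub_cancel_left]
  cases d with
  | zero => simp [chooseZ]
  | succ d => simp [chooseZ, Nat.choose_succ_succ]

theorem sum_range_neg_one_pow_mul_choose_sub (n k : ℕ) :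
    ∑ l ∈ Finset.range (k + 1), (-1 : ℚ) ^ l * (Nat.choose (n + 1) (k - l) : ℚ) =
      (Nat.choose n k : ℚ) := by
  induction k with
  | zero => simp
  | succ k ih =>
    have step : ∑ l ∈ Finset.range (k + 1),
        (-1 : ℚ) ^ (l + 1) * (Nat.choose (n + 1) (k + 1 - (l + 1)) : ℚ) =
        -(Nat.choose n k : ℚ) := by
      rw [← ih, ← Finset.sum_neg_distrib]
      refine Finset.sum_congr rfl fun l _ => ?_
      rw [Nat.add_sub_add_right]
      ring
    rw [Finset.sum_range_succ', step, Nat.sub_zero, Nat.choose_succ_succ]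
    push_cast
    ring

theorem sum_range_neg_one_pow_mul_succ_mul_choose_sub (n k : ℕ) :
    ∑ l ∈ Finset.range (k + 1),
        (-1 : ℚ) ^ l * (((l : ℚ) + 1) * (Nat.choose (n + 2) (k - l) : ℚ)) =
      (Nat.choose n k : ℚ) := by
  induction k with
  | zero => simp
  | succ k ih =>
    have step : ∑ l ∈ Finset.range (k + 1), (-1 : ℚ) ^ (l + 1) *
        ((((l + 1 : ℕ) : ℚ) + 1) * (Nat.choose (n + 2) (k + 1 - (l + 1)) : ℚ)) =
        -((Nat.choose n k : ℚ) + (Nat.choose (n + 1) k : ℚ)) := by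
      rw [← ih, ← sum_range_neg_one_pow_mul_choose_sub (n + 1) k, ← Finset.sum_add_distrib,
        ← Finset.sum_neg_distrib]
      refine Finset.sum_congr rfl fun l _ => ?_
      rw [Nat.add_sub_add_right]
      push_cast
      ring
    rw [Finset.sum_range_succ', step, Nat.sub_zero, Nat.choose_succ_succ (n + 1),
      Nat.choose_succ_succ n]
    push_cast
    ring

theorem sum_range_neg_one_pow_mul_succ_mul_add_two_mul_choose_sub (n k : ℕ) :
    ∑ l ∈ Finset.range (k + 1),
        (-1 : ℚ) ^ l * (((l : ℚ) + 1) * ((l : ℚ) + 2) * (Nat.choose (n + 3) (k - l) : ℚ)) =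
      2 * (Nat.choose n k : ℚ) := by
  induction k with
  | zero => simp
  | succ k ih =>
    have step : ∑ l ∈ Finset.range (k + 1), (-1 : ℚ) ^ (l + 1) *
        ((((l + 1 : ℕ) : ℚ) + 1) * (((l + 1 : ℕ) : ℚ) + 2) *
          (Nat.choose (n + 3) (k + 1 - (l + 1)) : ℚ)) =
        -(2 * (Nat.choose n k : ℚ) + 2 * (Nat.choose (n + 1) k : ℚ) +
          2 * (Nat.choose (n + 2) k : ℚ)) := by
      rw [← ih, ← sum_range_neg_one_pow_mul_succ_mul_choose_sub (n + 1) k,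
        ← sum_range_neg_one_pow_mul_choose_sub (n + 2) k, Finset.mul_sum, Finset.mul_sum,
        ← Finset.sum_add_distrib, ← Finset.sum_add_distrib, ← Finset.sum_neg_distrib]
      refine Finset.sum_congr rfl fun l _ => ?_
      rw [Nat.add_sub_add_right]
      push_cast
      ring
    rw [Finset.sum_range_succ', step, Nat.sub_zero, Nat.choose_succ_succ (n + 2),
      Nat.choose_succ_succ (n + 1), Nat.choose_succ_succ n]
    push_cast
    ring

/-- For every natural number `i`,
`Σ_{l=0}^{i} (−1)^l [((9i+12)l + 12i+15)·C(3i+4, i−l−1) + (l+2)^2·C(3i+5, i−l)]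
  = ((27i^3+101i^2+124i+48)/((3i+3)(3i+4))) · C(3i+4, i)`. -/
theorem theta_coefficient_identity (i : ℕ) :
    ∑ l ∈ Finset.range (i + 1),
      (-1 : ℚ) ^ l *
        (((9 * (i : ℚ) + 12) * (l : ℚ) + 12 * (i : ℚ) + 15) *
            chooseZ (3 * i + 4) ((i : ℤ) - (l : ℤ) - 1) +
          ((l : ℚ) + 2) ^ 2 * (Nat.choose (3 * i + 5) (i - l) : ℚ)) =
    ((27 * (i : ℚ) ^ 3 + 101 * (i : ℚ) ^ 2 + 124 * (i : ℚ) + 48) /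
        ((3 * (i : ℚ) + 3) * (3 * (i : ℚ) + 4))) * (Nat.choose (3 * i + 4) i : ℚ) := by
  have hQ : (Nat.choose (3 * i + 3) i : ℚ) * (3 * i + 4) =
      (Nat.choose (3 * i + 4) i : ℚ) * (2 * i + 4) := by
    have h := Nat.choose_mul_succ_eq (3 * i + 3) i
    rw [show 3 * i + 3 + 1 - i = 2 * i + 4 by omega] at h
    exact_mod_cast h
  have hR : (Nat.choose (3 * i + 2) i : ℚ) * (3 * i + 3) =
      (Nat.choose (3 * i + 3) i : ℚ) * (2 * i + 3) := by
    have h := Nat.choose_mul_succ_eq (3 * i + 2) i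
    rw [show 3 * i + 2 + 1 - i = 2 * i + 3 by omega] at h
    exact_mod_cast h
  have hsum : ∑ l ∈ Finset.range (i + 1),
      (-1 : ℚ) ^ l *
        (((9 * (i : ℚ) + 12) * (l : ℚ) + 12 * (i : ℚ) + 15) *
            chooseZ (3 * i + 4) ((i : ℤ) - (l : ℤ) - 1) +
          ((l : ℚ) + 2) ^ 2 * (Nat.choose (3 * i + 5) (i - l) : ℚ)) =
      (9 * (i : ℚ) + 12) *
          ((Nat.choose (3 * i + 3) i : ℚ) - (Nat.choose (3 * i + 2) i : ℚ)) +
        (3 * (i : ℚ) + 3) *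
          ((Nat.choose (3 * i + 4) i : ℚ) - (Nat.choose (3 * i + 3) i : ℚ)) +
        (2 * (Nat.choose (3 * i + 2) i : ℚ) + (Nat.choose (3 * i + 3) i : ℚ) +
          (Nat.choose (3 * i + 4) i : ℚ)) := by
    have hA₃ := sum_range_neg_one_pow_mul_choose_sub (3 * i + 3) i
    have hA₄ := sum_range_neg_one_pow_mul_choose_sub (3 * i + 4) i
    have hB₂ := sum_range_neg_one_pow_mul_succ_mul_choose_sub (3 * i + 2) i
    have hB₃ := sum_range_neg_one_pow_mul_succ_mul_choose_sub (3 * i + 3) i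
    have hC₂ := sum_range_neg_one_pow_mul_succ_mul_add_two_mul_choose_sub (3 * i + 2) i
    conv_rhs =>
      congr
      · congr
        · rw [← hB₃, ← hB₂]
        · rw [← hA₄, ← hA₃]
      · rw [← hC₂, ← hB₃, ← hA₄]
    simp only [Finset.mul_sum, ← Finset.sum_add_distrib, ← Finset.sum_sub_distrib]
    refine Finset.sum_congr rfl fun l hl => ?_
    rw [chooseZ_sub_sub_one _ (Finset.mem_range_succ_iff.mp hl)]
    ring
  rw [hsum]
  have h3 : (3 * (i : ℚ) + 3) ≠ 0 := by positivity
  have h4 : (3 * (i : ℚ) + 4) ≠ 0 := by positivity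
  rw [← eq_div_iff h4] at hQ
  rw [← eq_div_iff h3, hQ] at hR
  rw [hR, hQ]
  field_simp
  ring
end

section
/- For every natural number i, Σ_{l=0}^{i} (−1)^l ((9i+12)l + 12i+15) · C(3i+4, i−l−1) = ( 3i+6 − (13i^2+35i+24)/((3i+4)(i+1)) ) · C(3i+4, i). -/
theorem chooseZ_natCast (n m : ℕ) : chooseZ n (m : ℤ) = (n.choose m : ℚ) := by
  simp [chooseZ]

theorem chooseZ_of_neg (n : ℕ) {m : ℤ} (hm : m < 0) : chooseZ n m = 0 := by
  simp [chooseZ, hm]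

/-- Alternating sums of a row of Pascal's triangle with weights linear in the index. -/
theorem alternating_sum_linear_mul_choose (n k : ℕ) (a b : ℚ) :
    ∑ l ∈ Finset.range (k + 2), (-1 : ℚ) ^ l * (a * l + b) * ((n + 2).choose (k + 1 - l) : ℚ) =
      b * ((n + 1).choose (k + 1) : ℚ) - a * (n.choose k : ℚ) := by
  induction k generalizing b with
  | zero =>
    simp [Finset.sum_range_succ]
    ring
  | succ k ih =>
    have shift : ∑ l ∈ Finset.range (k + 2), (-1 : ℚ) ^ (l + 1) * (a * ((l + 1 : ℕ) : ℚ) + b) *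
        ((n + 2).choose (k + 1 + 1 - (l + 1)) : ℚ) =
        -∑ l ∈ Finset.range (k + 2), (-1 : ℚ) ^ l * (a * l + (a + b)) *
          ((n + 2).choose (k + 1 - l) : ℚ) := by
      rw [← Finset.sum_neg_distrib]
      refine Finset.sum_congr rfl fun l _ => ?_
      rw [Nat.add_sub_add_right]
      push_cast
      ring
    rw [Finset.sum_range_succ', shift, ih, Nat.sub_zero, Nat.choose_succ_succ' (n + 1) (k + 1),
      Nat.choose_succ_succ' n k]
    rw [Nat.choose_succ_succ' n (k + 1)]
    push_cast
    ring


/-- For every natural number `i`,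
`Σ_{l=0}^{i} (−1)^l ((9i+12)l + 12i+15) · C(3i+4, i−l−1)
  = (3i+6 − (13i^2+35i+24)/((3i+4)(i+1))) · C(3i+4, i)`. -/
theorem difference_coefficient_identity (i : ℕ) :
    ∑ l ∈ Finset.range (i + 1),
      (-1 : ℚ) ^ l * ((9 * (i : ℚ) + 12) * (l : ℚ) + 12 * (i : ℚ) + 15) *
        chooseZ (3 * i + 4) ((i : ℤ) - (l : ℤ) - 1) =
    (3 * (i : ℚ) + 6 -
        (13 * (i : ℚ) ^ 2 + 35 * (i : ℚ) + 24) / ((3 * (i : ℚ) + 4) * ((i : ℚ) + 1))) *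
      (Nat.choose (3 * i + 4) i : ℚ) := by
  rw [Finset.sum_range_succ, chooseZ_of_neg _ (by omega), mul_zero, add_zero]
  obtain _ | _ | k := i
  · norm_num
  · norm_num [chooseZ]
  · have sum_eq := alternating_sum_linear_mul_choose (3 * k + 8) k
      (9 * ((k + 2 : ℕ) : ℚ) + 12) (12 * ((k + 2 : ℕ) : ℚ) + 15)
    have h₁ := Nat.add_one_mul_choose_eq (3 * k + 9) (k + 1)
    have h₂ := Nat.add_one_mul_choose_eq (3 * k + 8) k
    rw [show 3 * (k + 1 + 1) + 4 = 3 * k + 9 + 1 by ring]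
    calc
      _ = ∑ l ∈ Finset.range (k + 2), (-1 : ℚ) ^ l *
            ((9 * ((k + 2 : ℕ) : ℚ) + 12) * l + (12 * ((k + 2 : ℕ) : ℚ) + 15)) *
            ((3 * k + 8 + 2).choose (k + 1 - l) : ℚ) := by
        refine Finset.sum_congr rfl fun l hl => ?_
        have hl' := Finset.mem_range.mp hl
        rw [show ((k + 1 + 1 : ℕ) : ℤ) - (l : ℤ) - 1 = ((k + 1 - l : ℕ) : ℤ) by omega,
          chooseZ_natCast]
        ring
      _ = _ := by
        rw [sum_eq]
        qify at h₁ h₂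
        push_cast
        have hC₁ : ((3 * k + 8 + 1).choose (k + 1) : ℚ) =
            (k + 2) / (3 * k + 10) * ((3 * k + 9 + 1).choose (k + 1 + 1) : ℚ) := by
          field_simp
          linear_combination h₁
        have hC₂ : ((3 * k + 8).choose k : ℚ) =
            (k + 1) / (3 * k + 9) * ((3 * k + 8 + 1).choose (k + 1) : ℚ) := by
          field_simp
          linear_combination h₂
        rw [hC₂, hC₁]
        field_simp
        ring
end
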